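/- Let N ≥ 2, k ∈ ℝ, ℓ ∈ ℕ ∪ {0} with ℓ(N−2+ℓ) ≥ −(N−2)^2/4 − k, and let P be a nonzero eigenfunction of −Δ_{S^{N−1}} with eigenvalue ℓ(N−2+ℓ). Then for every u ∈ C_0^∞(ℝ^N \ F_P), ∫_{ℝ^N} (−Δu + k|x|^{−2}u) ū dx ≥ [((N−2)/2)^2 + ℓ(N−2+ℓ) + k] ∫_{ℝ^N} |u|^2/|x|^2 dx ≥ 0. -/

import Mathlib

open MeasureTheory Real Metric

noncomputable section

/-- Euclidean Laplacian `Δ f = ∑ᵢ ∂²f/∂xᵢ²` on `ℝ^N`. -/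
def lap {N : ℕ} {F : Type} [NormedAddCommGroup F] [NormedSpace ℝ F]
    (f : EuclideanSpace ℝ (Fin N) → F) (x : EuclideanSpace ℝ (Fin N)) : F :=
  ∑ i : Fin N, fderiv ℝ (fun y => fderiv ℝ f y (EuclideanSpace.single i 1)) x
    (EuclideanSpace.single i 1)

/-- Squared norm of the gradient: `‖∇f(x)‖² = ∑ᵢ ‖∂f/∂xᵢ(x)‖²`. -/
def gradSq {N : ℕ} {F : Type} [NormedAddCommGroup F] [NormedSpace ℝ F]
    (f : EuclideanSpace ℝ (Fin N) → F) (x : EuclideanSpace ℝ (Fin N)) : ℝ :=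
  ∑ i : Fin N, ‖fderiv ℝ f x (EuclideanSpace.single i 1)‖ ^ 2

/-- `P : ℝ^N → ℝ`, viewed via its restriction to the unit sphere `S^{N-1}`, is an
eigenfunction of the negative Laplace-Beltrami operator `-Δ_{S^{N-1}}` with eigenvalue
`λ_ℓ = ℓ(N-2+ℓ)`.  This is characterized by the smoothness and harmonicity on `ℝ^N \ {0}`
of the degree-`ℓ` homogeneous extension `x ↦ ‖x‖^ℓ P(x/‖x‖)`. -/
def IsSphEigen (N ℓ : ℕ) (P : EuclideanSpace ℝ (Fin N) → ℝ) : Prop :=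
  ContDiffOn ℝ (⊤ : ℕ∞) (fun x : EuclideanSpace ℝ (Fin N) => ‖x‖ ^ ℓ * P (‖x‖⁻¹ • x)) {0}ᶜ ∧
  ∀ x : EuclideanSpace ℝ (Fin N), x ≠ 0 →
    lap (fun y : EuclideanSpace ℝ (Fin N) => ‖y‖ ^ ℓ * P (‖y‖⁻¹ • y)) x = 0

/-- `P` is not identically zero on the unit sphere. -/
def SphNonzero (N : ℕ) (P : EuclideanSpace ℝ (Fin N) → ℝ) : Prop :=
  ∃ ω : EuclideanSpace ℝ (Fin N), ‖ω‖ = 1 ∧ P ω ≠ 0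

/-- `F_P`: the cone over the zero set of `P` on the sphere, together with the origin. -/
def conicZeroSet (N : ℕ) (P : EuclideanSpace ℝ (Fin N) → ℝ) : Set (EuclideanSpace ℝ (Fin N)) :=
  {x : EuclideanSpace ℝ (Fin N) | x ≠ 0 ∧ P (‖x‖⁻¹ • x) = 0} ∪ {0}

/-- `P` has unit `L²` norm on the unit sphere (with its surface measure). -/
def SphNormalized (N : ℕ) (P : EuclideanSpace ℝ (Fin N) → ℝ) : Prop :=
  ∫ ω : sphere (0 : EuclideanSpace ℝ (Fin N)) 1, (P ω.1) ^ 2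
    ∂((volume : Measure (EuclideanSpace ℝ (Fin N))).toSphere) = 1

/-- The function `u_m(x) = m^{-1/2} φ(log‖x‖/m) ‖x‖^{-N/2+1} P(x/‖x‖)`. -/
def uFam (N : ℕ) (P : EuclideanSpace ℝ (Fin N) → ℝ) (φ : ℝ → ℝ) (m : ℕ)
    (x : EuclideanSpace ℝ (Fin N)) : ℝ :=
  (m : ℝ) ^ (-(1 : ℝ)/2) * φ (Real.log ‖x‖ / m) * ‖x‖ ^ (-(N : ℝ)/2 + 1) * P (‖x‖⁻¹ • x)

open scoped InnerProductSpace

section Support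

variable {E F G : Type*} [NormedAddCommGroup E] [NormedSpace ℝ E]
  [NormedAddCommGroup F] [NormedSpace ℝ F] [Zero G]

theorem contDiff_of_forall_mem_tsupport {n : WithTop ℕ∞} {u : E → G} {f : E → F}
    (h0 : ∀ x, u x = 0 → f x = 0) (hf : ∀ x ∈ tsupport u, ContDiffAt ℝ n f x) :
    ContDiff ℝ n f := by
  rw [contDiff_iff_contDiffAt]
  intro x
  by_cases hx : x ∈ tsupport u
  · exact hf x hx
  · have h : f =ᶠ[nhds x] fun _ => 0 := by
      filter_upwards [notMem_tsupport_iff_eventuallyEq.1 hx] with y hy using h0 y hy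
    exact contDiffAt_const.congr_of_eventuallyEq h

theorem continuous_of_forall_mem_tsupport {u : E → G} {f : E → F}
    (h0 : ∀ x, u x = 0 → f x = 0) (hf : ∀ x ∈ tsupport u, ContDiffAt ℝ 0 f x) :
    Continuous f :=
  (contDiff_of_forall_mem_tsupport h0 hf).continuous

end Support

theorem integral_fderiv_apply_eq_zero {E : Type*} [NormedAddCommGroup E] [NormedSpace ℝ E]
    [FiniteDimensional ℝ E] [MeasurableSpace E] [BorelSpace E] (μ : Measure E)
    [μ.IsAddHaarMeasure] {g : E → ℝ} (hg : ContDiff ℝ 1 g) (hc : HasCompactSupport g) (v : E) :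
    ∫ x, fderiv ℝ g x v ∂μ = 0 := by
  have hd : Integrable (fun x => fderiv ℝ g x v) μ :=
    ((hg.continuous_fderiv one_ne_zero).clm_apply continuous_const).integrable_of_hasCompactSupport
      (hc.fderiv_apply (𝕜 := ℝ) v)
  have h := integral_mul_fderiv_eq_neg_fderiv_mul_of_integrable (μ := μ) (𝕜 := ℝ)
    (f := fun _ : E => (1 : ℝ)) (g := g) (v := v) (by simp) (by simpa using hd)
    (by simpa using hg.continuous.integrable_of_hasCompactSupport hc)
    (fun _ _ => by fun_prop)
    (fun x _ => hg.differentiable one_ne_zero x)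
  simpa using h

theorem fderiv_apply_self_of_homogeneous {E : Type*} [NormedAddCommGroup E] [NormedSpace ℝ E]
    {Q : E → ℝ} {ℓ : ℕ} {x : E} (hQ : DifferentiableAt ℝ Q x)
    (hom : ∀ t : ℝ, 0 < t → Q (t • x) = t ^ ℓ * Q x) :
    fderiv ℝ Q x x = ℓ * Q x := by
  have h1 : HasDerivAt (fun t : ℝ => Q (t • x)) (fderiv ℝ Q x x) 1 := by
    have hs : HasDerivAt (fun t : ℝ => t • x) x 1 := by
      simpa using (hasDerivAt_id (1 : ℝ)).smul_const x
    exact HasFDerivAt.comp_hasDerivAt (x := (1 : ℝ)) (l := Q) (f := fun t : ℝ => t • x)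
      (by simpa using hQ.hasFDerivAt) hs
  have h2 : HasDerivAt (fun t : ℝ => Q (t • x)) (ℓ * Q x) 1 := by
    have h : HasDerivAt (fun t : ℝ => t ^ ℓ * Q x) (ℓ * Q x) 1 := by
      simpa using (hasDerivAt_pow ℓ (1 : ℝ)).mul_const (Q x)
    refine h.congr_of_eventuallyEq ?_
    filter_upwards [lt_mem_nhds (zero_lt_one : (0 : ℝ) < 1)] with t ht using hom t ht
  exact h1.unique h2

/-- The `i`-th component of the logarithmic gradient of `y ↦ ‖y‖ ^ (-a) * Q y`. -/
def logGrad {N : ℕ} (a : ℝ) (Q : EuclideanSpace ℝ (Fin N) → ℝ) (i : Fin N)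
    (y : EuclideanSpace ℝ (Fin N)) : ℝ :=
  fderiv ℝ Q y (EuclideanSpace.single i 1) / Q y - a * (y i / ‖y‖ ^ 2)

section LogGrad

variable {N : ℕ} {Q : EuclideanSpace ℝ (Fin N) → ℝ} {x : EuclideanSpace ℝ (Fin N)}

theorem contDiffAt_coord {n : WithTop ℕ∞} (i : Fin N) :
    ContDiffAt ℝ n (fun y : EuclideanSpace ℝ (Fin N) => y i) x :=
  (EuclideanSpace.proj (𝕜 := ℝ) i).contDiff.contDiffAt

theorem contDiffAt_logGrad (a : ℝ) (i : Fin N) (hQ : ContDiffAt ℝ 2 Q x) (hx : x ≠ 0)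
    (hQx : Q x ≠ 0) : ContDiffAt ℝ 1 (logGrad a Q i) x := by
  have h1 : ContDiffAt ℝ 1 (fun y => fderiv ℝ Q y (EuclideanSpace.single i 1)) x :=
    (hQ.fderiv_right (m := 1) (by norm_num)).clm_apply contDiffAt_const
  have h2 : ContDiffAt ℝ 1 (fun y : EuclideanSpace ℝ (Fin N) => ‖y‖ ^ 2) x :=
    contDiffAt_id.norm_sq ℝ
  exact (h1.div (hQ.of_le (by norm_num)) hQx).sub
    (contDiffAt_const.mul ((contDiffAt_coord i).div h2 (by simpa using hx)))

theorem fderiv_logGrad (a : ℝ) (i : Fin N) (hQ : ContDiffAt ℝ 2 Q x) (hx : x ≠ 0)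
    (hQx : Q x ≠ 0) :
    fderiv ℝ (logGrad a Q i) x (EuclideanSpace.single i 1) =
      fderiv ℝ (fun y => fderiv ℝ Q y (EuclideanSpace.single i 1)) x
          (EuclideanSpace.single i 1) / Q x
        - (fderiv ℝ Q x (EuclideanSpace.single i 1) / Q x) ^ 2
        - a * (1 / ‖x‖ ^ 2 - 2 * x i ^ 2 / ‖x‖ ^ 4) := by
  have h1 : DifferentiableAt ℝ (fun y => fderiv ℝ Q y (EuclideanSpace.single i 1)) x :=
    ((hQ.fderiv_right (m := 1) (by norm_num)).clm_apply contDiffAt_const).differentiableAt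
      one_ne_zero
  have hQd : HasFDerivAt Q (fderiv ℝ Q x) x := (hQ.differentiableAt two_ne_zero).hasFDerivAt
  have h2 : HasFDerivAt (fun y : EuclideanSpace ℝ (Fin N) => ‖y‖ ^ 2) (2 • innerSL ℝ x) x :=
    (hasStrictFDerivAt_norm_sq x).hasFDerivAt
  have h3 : HasFDerivAt (fun y : EuclideanSpace ℝ (Fin N) => y i)
      (EuclideanSpace.proj (𝕜 := ℝ) i) x := (EuclideanSpace.proj (𝕜 := ℝ) i).hasFDerivAt
  have hn : ‖x‖ ≠ 0 := by simpa using hx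
  have hQi := (hasDerivAt_inv hQx).comp_hasFDerivAt x hQd
  have hni := (hasDerivAt_inv (pow_ne_zero 2 hn)).comp_hasFDerivAt x h2
  have h := (h1.hasFDerivAt.mul hQi).sub ((h3.mul hni).const_mul a)
  have heq : logGrad a Q i = (fun y => fderiv ℝ Q y (EuclideanSpace.single i 1)) *
      (Inv.inv ∘ Q) - fun y => a * ((fun y : EuclideanSpace ℝ (Fin N) => y i) *
        (Inv.inv ∘ fun y : EuclideanSpace ℝ (Fin N) => ‖y‖ ^ 2)) y := by
    ext y
    simp [logGrad, div_eq_mul_inv]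
  rw [heq, h.fderiv]
  have hin : ⟪x, EuclideanSpace.single i 1⟫_ℝ = x i := by
    simp [EuclideanSpace.inner_single_right]
  simp [hin]
  field_simp
  ring

/-- The Riccati identity `div F + |F|² = -a² / ‖x‖²` for the logarithmic gradient `F`. -/
theorem sum_fderiv_logGrad_add_sq {ℓ : ℕ} {a : ℝ} (ha : a = ((N : ℝ) - 2) / 2 + ℓ)
    (hQ : ContDiffAt ℝ 2 Q x) (hx : x ≠ 0) (hQx : Q x ≠ 0) (hlap : lap Q x = 0)
    (heuler : fderiv ℝ Q x x = ℓ * Q x) :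
    ∑ i, (fderiv ℝ (logGrad a Q i) x (EuclideanSpace.single i 1) + logGrad a Q i x ^ 2) =
      -a ^ 2 / ‖x‖ ^ 2 := by
  have hn : ‖x‖ ≠ 0 := by simpa using hx
  have hsq : ∑ i, x i ^ 2 = ‖x‖ ^ 2 := (EuclideanSpace.real_norm_sq_eq x).symm
  have hsum : ∑ i, x i * fderiv ℝ Q x (EuclideanSpace.single i 1) = ℓ * Q x := by
    rw [← heuler]
    conv_rhs => enter [2]; rw [← (EuclideanSpace.basisFun (Fin N) ℝ).sum_repr x]
    simp
  have hterm : ∀ i, fderiv ℝ (logGrad a Q i) x (EuclideanSpace.single i 1)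
      + logGrad a Q i x ^ 2 =
      fderiv ℝ (fun y => fderiv ℝ Q y (EuclideanSpace.single i 1)) x
          (EuclideanSpace.single i 1) * (1 / Q x)
        - x i * fderiv ℝ Q x (EuclideanSpace.single i 1) * (2 * a / (Q x * ‖x‖ ^ 2))
        + x i ^ 2 * ((2 * a + a ^ 2) / ‖x‖ ^ 4) - a / ‖x‖ ^ 2 := by
    intro i
    rw [fderiv_logGrad a i hQ hx hQx, logGrad]
    field_simp
    ring
  simp_rw [hterm]
  rw [Finset.sum_sub_distrib, Finset.sum_add_distrib, Finset.sum_sub_distrib, ← Finset.sum_mul,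
    ← Finset.sum_mul, ← Finset.sum_mul, hsq, hsum]
  have hl : ∑ i : Fin N, fderiv ℝ (fun y => fderiv ℝ Q y (EuclideanSpace.single i 1)) x
    (EuclideanSpace.single i 1) = 0 := hlap
  rw [hl]
  simp only [Finset.sum_const, Finset.card_univ, Fintype.card_fin, nsmul_eq_mul]
  have hNa : (N : ℝ) = 2 * a - 2 * ℓ + 2 := by rw [ha]; ring
  rw [hNa]
  field_simp
  ring

end LogGrad

section Pointwise

variable {N : ℕ} {u : EuclideanSpace ℝ (Fin N) → ℂ} {x : EuclideanSpace ℝ (Fin N)}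

theorem contDiffAt_fderiv_single {n : WithTop ℕ∞} (hu : ContDiffAt ℝ (n + 1) u x) (i : Fin N) :
    ContDiffAt ℝ n (fun y => fderiv ℝ u y (EuclideanSpace.single i 1)) x :=
  (hu.fderiv_right le_rfl).clm_apply contDiffAt_const

/-- The `i`-th component of the vector field whose divergence is the defect in the
ground state representation. -/
def defectField (F : EuclideanSpace ℝ (Fin N) → ℝ) (u : EuclideanSpace ℝ (Fin N) → ℂ)
    (i : Fin N) (y : EuclideanSpace ℝ (Fin N)) : ℝ :=
  ⟪u y, fderiv ℝ u y (EuclideanSpace.single i 1)⟫_ℝ - F y * ‖u y‖ ^ 2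

theorem defectField_eq_zero (F : EuclideanSpace ℝ (Fin N) → ℝ) (i : Fin N) (h : u x = 0) :
    defectField F u i x = 0 := by
  simp [defectField, h]

theorem contDiffAt_defectField {F : EuclideanSpace ℝ (Fin N) → ℝ} (hu : ContDiffAt ℝ 2 u x)
    (hF : ContDiffAt ℝ 1 F x) (i : Fin N) : ContDiffAt ℝ 1 (defectField F u i) x := by
  have hu1 : ContDiffAt ℝ 1 u x := hu.of_le (by norm_num)
  have hd : ContDiffAt ℝ 1 (fun y => fderiv ℝ u y (EuclideanSpace.single i 1)) x :=
    contDiffAt_fderiv_single (hu.of_le (by norm_num)) i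
  exact (hu1.inner ℝ hd).sub (hF.mul (hu1.norm_sq ℝ))

theorem fderiv_defectField {F : EuclideanSpace ℝ (Fin N) → ℝ} (hu : ContDiffAt ℝ 2 u x)
    (hF : ContDiffAt ℝ 1 F x) (i : Fin N) :
    fderiv ℝ (defectField F u i) x (EuclideanSpace.single i 1) =
      ⟪u x, fderiv ℝ (fun y => fderiv ℝ u y (EuclideanSpace.single i 1)) x
          (EuclideanSpace.single i 1)⟫_ℝ
        + ‖fderiv ℝ u x (EuclideanSpace.single i 1) - F x • u x‖ ^ 2
        - (fderiv ℝ F x (EuclideanSpace.single i 1) + F x ^ 2) * ‖u x‖ ^ 2 := by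
  have hud : HasFDerivAt u (fderiv ℝ u x) x := (hu.differentiableAt two_ne_zero).hasFDerivAt
  have hd : ContDiffAt ℝ 1 (fun y => fderiv ℝ u y (EuclideanSpace.single i 1)) x :=
    contDiffAt_fderiv_single (hu.of_le (by norm_num)) i
  have hdd := (hd.differentiableAt one_ne_zero).hasFDerivAt
  have hFd := (hF.differentiableAt one_ne_zero).hasFDerivAt
  have h := (hud.inner ℝ hdd).sub (hFd.mul hud.norm_sq)
  have h' : HasFDerivAt (defectField F u i) _ x := h
  rw [h'.fderiv, norm_sub_sq_real, norm_smul, inner_smul_right,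
    real_inner_comm (u x) (fderiv ℝ u x (EuclideanSpace.single i 1)), mul_pow, Real.norm_eq_abs,
    sq_abs, ← real_inner_self_eq_norm_sq (fderiv ℝ u x (EuclideanSpace.single i 1))]
  simp [fderivInnerCLM_apply, -Complex.inner]
  ring

theorem le_add_sum_fderiv_defectField {F : Fin N → EuclideanSpace ℝ (Fin N) → ℝ} {c : ℝ}
    (hu : ContDiffAt ℝ 2 u x) (hF : ∀ i, ContDiffAt ℝ 1 (F i) x)
    (hc : ∑ i, (fderiv ℝ (F i) x (EuclideanSpace.single i 1) + F i x ^ 2) = -c) :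
    c * ‖u x‖ ^ 2 ≤ ⟪u x, -lap u x⟫_ℝ +
      ∑ i, fderiv ℝ (defectField (F i) u i) x (EuclideanSpace.single i 1) := by
  simp_rw [fun i => fderiv_defectField hu (hF i) i]
  rw [Finset.sum_sub_distrib, Finset.sum_add_distrib, ← Finset.sum_mul, hc, ← inner_sum, lap,
    inner_neg_right]
  have : 0 ≤ ∑ i, ‖fderiv ℝ u x (EuclideanSpace.single i 1) - F i x • u x‖ ^ 2 := by positivity
  linarith

end Pointwise

section Eigen

variable {N ℓ : ℕ} {P : EuclideanSpace ℝ (Fin N) → ℝ} {x : EuclideanSpace ℝ (Fin N)}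

theorem ne_zero_of_notMem_conicZeroSet (hx : x ∉ conicZeroSet N P) : x ≠ 0 :=
  fun h => hx (Or.inr h)

theorem extension_ne_zero_of_notMem_conicZeroSet (hx : x ∉ conicZeroSet N P) :
    ‖x‖ ^ ℓ * P (‖x‖⁻¹ • x) ≠ 0 := by
  have h0 := ne_zero_of_notMem_conicZeroSet hx
  exact mul_ne_zero (pow_ne_zero _ (norm_ne_zero_iff.2 h0)) fun h => hx (Or.inl ⟨h0, h⟩)

theorem extension_smul (P : EuclideanSpace ℝ (Fin N) → ℝ) (x : EuclideanSpace ℝ (Fin N))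
    {t : ℝ} (ht : 0 < t) :
    ‖t • x‖ ^ ℓ * P (‖t • x‖⁻¹ • t • x) = t ^ ℓ * (‖x‖ ^ ℓ * P (‖x‖⁻¹ • x)) := by
  rw [norm_smul, Real.norm_of_nonneg ht.le, mul_pow, smul_smul, mul_inv, mul_comm t⁻¹, mul_assoc,
    mul_assoc ‖x‖⁻¹, inv_mul_cancel₀ ht.ne', mul_one]

theorem IsSphEigen.contDiffAt (hP : IsSphEigen N ℓ P) (hx : x ≠ 0) :
    ContDiffAt ℝ 2 (fun x => ‖x‖ ^ ℓ * P (‖x‖⁻¹ • x)) x :=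
  (hP.1.contDiffAt (isOpen_compl_singleton.mem_nhds hx)).of_le (WithTop.coe_le_coe.2 le_top)

end Eigen

theorem stmt10 (N ℓ : ℕ) (hN : 2 ≤ N) (k : ℝ)
    (hk : (ℓ : ℝ) * ((N : ℝ) - 2 + ℓ) ≥ -((N : ℝ) - 2) ^ 2 / 4 - k)
    (P : EuclideanSpace ℝ (Fin N) → ℝ)
    (hP : IsSphEigen N ℓ P) (hP0 : SphNonzero N P)
    (u : EuclideanSpace ℝ (Fin N) → ℂ)
    (hu : ContDiff ℝ (⊤ : ℕ∞) u) (hcs : HasCompactSupport u)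
    (hsupp : tsupport u ⊆ (conicZeroSet N P)ᶜ) :
    ((((N : ℝ) - 2)/2) ^ 2 + (ℓ : ℝ) * ((N : ℝ) - 2 + ℓ) + k)
        * ∫ x, ‖u x‖ ^ 2 / ‖x‖ ^ 2
      ≤ (∫ x, (-lap u x + ((k / ‖x‖ ^ 2 : ℝ) : ℂ) * u x) * (starRingEnd ℂ) (u x)).re ∧
    0 ≤ ((((N : ℝ) - 2)/2) ^ 2 + (ℓ : ℝ) * ((N : ℝ) - 2 + ℓ) + k)
        * ∫ x, ‖u x‖ ^ 2 / ‖x‖ ^ 2 := by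
  set c : ℝ := (((N : ℝ) - 2)/2) ^ 2 + (ℓ : ℝ) * ((N : ℝ) - 2 + ℓ) + k with hc
  have hc0 : 0 ≤ c := by rw [hc]; linarith
  refine ⟨?_, mul_nonneg hc0 (integral_nonneg fun x => by positivity)⟩
  have hΩ : ∀ x ∈ tsupport u, x ∉ conicZeroSet N P := fun x hx => hsupp hx
  have hu2 : ContDiff ℝ 2 u := hu.of_le (WithTop.coe_le_coe.2 le_top)
  have compact_of : ∀ {F : Type} [NormedAddCommGroup F] {f : EuclideanSpace ℝ (Fin N) → F},
      (∀ x, u x = 0 → f x = 0) → HasCompactSupport f := fun h0 =>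
    hcs.mono fun x hx hux => hx (h0 x hux)
  have hn : ∀ x ∈ tsupport u,
      ContDiffAt ℝ 0 (fun y : EuclideanSpace ℝ (Fin N) => ‖y‖ ^ 2) x := fun x _ =>
    contDiffAt_id.norm_sq ℝ
  have hn0 : ∀ x ∈ tsupport u, ‖x‖ ^ 2 ≠ 0 := fun x hx =>
    pow_ne_zero 2 (norm_ne_zero_iff.2 (ne_zero_of_notMem_conicZeroSet (hΩ x hx)))
  set Q : EuclideanSpace ℝ (Fin N) → ℝ := fun x => ‖x‖ ^ ℓ * P (‖x‖⁻¹ • x) with hQ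
  set a : ℝ := ((N : ℝ) - 2) / 2 + ℓ with ha
  have hF : ∀ x ∈ tsupport u, ∀ i, ContDiffAt ℝ 1 (logGrad a Q i) x := fun x hx i =>
    contDiffAt_logGrad a i (hP.contDiffAt (ne_zero_of_notMem_conicZeroSet (hΩ x hx)))
      (ne_zero_of_notMem_conicZeroSet (hΩ x hx))
      (extension_ne_zero_of_notMem_conicZeroSet (hΩ x hx))
  have hG0 : ∀ i x, u x = 0 → defectField (logGrad a Q i) u i x = 0 := fun i x =>
    defectField_eq_zero _ i
  have hG : ∀ i, ContDiff ℝ 1 (defectField (logGrad a Q i) u i) := fun i =>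
    contDiff_of_forall_mem_tsupport (hG0 i) fun x hx =>
      contDiffAt_defectField hu2.contDiffAt (hF x hx i) i
  have hGi : ∀ i, Integrable fun x =>
      fderiv ℝ (defectField (logGrad a Q i) u i) x (EuclideanSpace.single i 1) := fun i =>
    (((hG i).continuous_fderiv one_ne_zero).clm_apply
      continuous_const).integrable_of_hasCompactSupport
        ((compact_of (hG0 i)).fderiv_apply (𝕜 := ℝ) _)
  have hlap : Continuous (lap u) := by
    refine continuous_finsetSum _ fun i _ => ?_
    have hd : ContDiff ℝ 1 (fun y => fderiv ℝ u y (EuclideanSpace.single i 1)) :=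
      (hu2.fderiv_right (m := 1) (by norm_num)).clm_apply contDiff_const
    exact (hd.continuous_fderiv one_ne_zero).clm_apply continuous_const
  have hw0 : ∀ x, u x = 0 → ‖u x‖ ^ 2 / ‖x‖ ^ 2 = 0 := fun x hx => by simp [hx]
  have hw : Integrable fun x => ‖u x‖ ^ 2 / ‖x‖ ^ 2 :=
    (continuous_of_forall_mem_tsupport hw0 fun x hx =>
      (((hu2.of_le zero_le_two).contDiffAt.norm_sq ℝ).div (hn x hx)
        (hn0 x hx))).integrable_of_hasCompactSupport (compact_of hw0)
  have hv0 : ∀ x, u x = 0 →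
      (-lap u x + ((k / ‖x‖ ^ 2 : ℝ) : ℂ) * u x) * (starRingEnd ℂ) (u x) = 0 :=
    fun x hx => by simp [hx]
  have hv : Integrable fun x =>
      (-lap u x + ((k / ‖x‖ ^ 2 : ℝ) : ℂ) * u x) * (starRingEnd ℂ) (u x) := by
    refine (continuous_of_forall_mem_tsupport hv0 fun x hx => ?_).integrable_of_hasCompactSupport
      (compact_of hv0)
    have hu0 : ContDiffAt ℝ 0 u x := (hu2.of_le zero_le_two).contDiffAt
    have hk0 : ContDiffAt ℝ 0
        (fun y : EuclideanSpace ℝ (Fin N) => ((k / ‖y‖ ^ 2 : ℝ) : ℂ)) x :=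
      Complex.ofRealCLM.contDiff.contDiffAt.comp x
        (contDiffAt_const.div (hn x hx) (hn0 x hx))
    exact ((contDiff_zero.2 hlap).contDiffAt.neg.add (hk0.mul hu0)).mul
      (Complex.conjCLE.contDiff.contDiffAt.comp x hu0)
  have hre : ∀ x, ((-lap u x + ((k / ‖x‖ ^ 2 : ℝ) : ℂ) * u x) * (starRingEnd ℂ) (u x)).re =
      ⟪u x, -lap u x⟫_ℝ + k * (‖u x‖ ^ 2 / ‖x‖ ^ 2) := fun x => by
    rw [← Complex.inner, inner_add_right, ← Complex.real_smul, inner_smul_right,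
      real_inner_self_eq_norm_sq]
    ring
  have hpt : ∀ x, c * (‖u x‖ ^ 2 / ‖x‖ ^ 2) ≤
      ((-lap u x + ((k / ‖x‖ ^ 2 : ℝ) : ℂ) * u x) * (starRingEnd ℂ) (u x)).re +
        ∑ i, fderiv ℝ (defectField (logGrad a Q i) u i) x (EuclideanSpace.single i 1) := by
    intro x
    by_cases hx : x ∈ tsupport u
    · have hx0 := ne_zero_of_notMem_conicZeroSet (hΩ x hx)
      have h := le_add_sum_fderiv_defectField (F := logGrad a Q) (c := a ^ 2 / ‖x‖ ^ 2)
        hu2.contDiffAt (hF x hx) (by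
          rw [← neg_div]
          exact sum_fderiv_logGrad_add_sq ha (hP.contDiffAt hx0) hx0
            (extension_ne_zero_of_notMem_conicZeroSet (hΩ x hx)) (hP.2 x hx0)
            (fderiv_apply_self_of_homogeneous
              ((hP.contDiffAt hx0).differentiableAt two_ne_zero)
              fun t ht => extension_smul P x ht))
      have hca : c = a ^ 2 + k := by rw [hc, ha]; ring
      rw [hre, hca]
      calc (a ^ 2 + k) * (‖u x‖ ^ 2 / ‖x‖ ^ 2)
          = a ^ 2 / ‖x‖ ^ 2 * ‖u x‖ ^ 2 + k * (‖u x‖ ^ 2 / ‖x‖ ^ 2) := by ring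
        _ ≤ _ := by linarith
    · have hGx : ∀ i, fderiv ℝ (defectField (logGrad a Q i) u i) x
          (EuclideanSpace.single i 1) = 0 := fun i => by
        have h : defectField (logGrad a Q i) u i =ᶠ[nhds x] fun _ => 0 := by
          filter_upwards [notMem_tsupport_iff_eventuallyEq.1 hx] with y hy using hG0 i y hy
        simp [h.fderiv_eq]
      simp [hGx, image_eq_zero_of_notMem_tsupport hx]
  have hint := integral_mono (hw.const_mul c) (hv.re.add (integrable_finsetSum _ fun i _ => hGi i))
    hpt
  rw [integral_const_mul] at hint
  refine hint.trans_eq ?_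
  rw [integral_add' hv.re (integrable_finsetSum _ fun i _ => hGi i),
    integral_finsetSum _ fun i _ => hGi i,
    Finset.sum_eq_zero fun i _ => integral_fderiv_apply_eq_zero volume (hG i)
      (compact_of (hG0 i)) _, add_zero]
  exact integral_re hv
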